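/- Let p be any probability vector on {1,…,k}. For every n≥1 and every path g:{0,…,n}→ℤ_+^k with g(0)=0, g(m)−g(m−1)∈{e_1,…,e_k} for 1≤m≤n, and g(m)∈W for all m≤n, the probability that the transformed walk follows g is a Schur polynomial evaluated at p: P((G^{(k)}(X))(m)=g(m) for all 0≤m≤n) = s_{g(n)^*}(p). -/

import Mathlib

open MeasureTheory ProbabilityTheory

noncomputable def minOp (x y : ℕ → ℤ) : ℕ → ℤ := fun n =>
  Finset.inf' (Finset.range (n+1)) (by simp) (fun m => x m + y n - y m)

noncomputable def maxOp (x y : ℕ → ℤ) : ℕ → ℤ := fun n =>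
  Finset.sup' (Finset.range (n+1)) (by simp) (fun m => x m + y n - y m)

/-- `Dseq x i = x 0 ⊓ x 1 ⊓ ⋯ ⊓ x i` (left to right). -/
noncomputable def Dseq (x : ℕ → ℕ → ℤ) : ℕ → (ℕ → ℤ)
  | 0 => x 0
  | i+1 => minOp (Dseq x i) (x (i+1))

/-- `Tseq x i = x (i+1) ⊔ (x 0 ⊓ ⋯ ⊓ x i)`. -/
noncomputable def Tseq (x : ℕ → ℕ → ℤ) : ℕ → (ℕ → ℤ) :=
  fun i => maxOp (x (i+1)) (Dseq x i)

/-- The path transformation `G^{(k)}` (coordinates `0,…,k-1`). -/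
noncomputable def G : ℕ → (ℕ → ℕ → ℤ) → (ℕ → ℕ → ℤ)
  | 0, x => x
  | 1, x => x
  | (k+2), x => fun i => match i with
      | 0 => Dseq x (k+1)
      | (j+1) => G (k+1) (Tseq x) j

/-- The cells of the Young diagram of shape `lam` (row lengths), within the
first `k` rows. -/
def cells (k : ℕ) (lam : ℕ → ℕ) : Finset (ℕ × ℕ) :=
  (Finset.range k ×ˢ Finset.range ((Finset.range k).sup lam)).filter
    (fun rc => rc.2 < lam rc.1)

/-- `T` is a semistandard Young tableau of shape `lam` with entries in
`{0,…,k-1}` (0-based version of entries `{1,…,k}`): rows weakly increase,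
columns strictly increase, and `T` vanishes outside the diagram. -/
def IsSSYT (k : ℕ) (lam : ℕ → ℕ) (T : ℕ → ℕ → ℕ) : Prop :=
  (∀ r c, c < lam r → T r c < k) ∧
  (∀ r c, ¬ c < lam r → T r c = 0) ∧
  (∀ r c c', c ≤ c' → c' < lam r → T r c ≤ T r c') ∧
  (∀ r r' c, r < r' → c < lam r' → T r c < T r' c)

/-- Number of entries of `T` (of shape `lam`, within `k` rows) equal to `i`. -/
def entryCount (k : ℕ) (lam : ℕ → ℕ) (T : ℕ → ℕ → ℕ) (i : ℕ) : ℕ :=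
  ((cells k lam).filter (fun rc => T rc.1 rc.2 = i)).card

/-- The Schur polynomial `s_lam(p) = ∑_T p^{weight(T)}`, summing over all
semistandard tableaux of shape `lam` with entries in `{0,…,k-1}`. -/
noncomputable def schur (k : ℕ) (lam : ℕ → ℕ) (p : ℕ → ℝ) : ℝ :=
  ∑' T : {T : ℕ → ℕ → ℕ // IsSSYT k lam T},
    ∏ i ∈ Finset.range k, p i ^ entryCount k lam T.1 i

/-- The Kostka number `κ_{lam,w}`: the number of semistandard tableaux of shape
`lam` with entries in `{0,…,k-1}` and weight `w`. -/
noncomputable def kostka (k : ℕ) (lam : ℕ → ℕ) (w : ℕ → ℕ) : ℕ :=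
  Set.ncard {T : ℕ → ℕ → ℕ | IsSSYT k lam T ∧ ∀ i, i < k → entryCount k lam T i = w i}

/-- The reversed vector `x^*` of a nonnegative integer vector, as a shape. -/
def revPartZ (k : ℕ) (x : ℕ → ℤ) : ℕ → ℕ :=
  fun j => if j < k then (x (k-1-j)).toNat else 0

/-- The counting walk of the i.i.d. letters `ξ`:
`Xcnt ξ i n ω = #{m < n : ξ m ω = i}` (as an integer). -/
def Xcnt {Ω : Type*} (ξ : ℕ → Ω → ℕ) (i : ℕ) (n : ℕ) (ω : Ω) : ℤ :=
  ((((Finset.range n).filter (fun m => ξ m ω = i))).card : ℤ)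


/-- Gelfand–Tsetlin patterns with rows `0,…,k-1`, row `r` having entries `0,…,r`. -/
structure GTP (k : ℕ) (L : ℕ → ℕ → ℤ) : Prop where
  nonneg : ∀ r i, i ≤ r → r < k → 0 ≤ L r i
  le1 : ∀ r i, i ≤ r → r + 1 < k → L (r+1) i ≤ L r i
  le2 : ∀ r i, i ≤ r → r + 1 < k → L r i ≤ L (r+1) (i+1)

/-- Insertion of the letter `a`, with bumping route `σ`. -/
structure Ins (k a : ℕ) (σ : ℕ → ℕ) (L L' : ℕ → ℕ → ℤ) : Prop where
  ha : a < k
  below : ∀ r i, r < a → i ≤ r → L' r i = L r i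
  hσ : ∀ r, a ≤ r → r < k → σ r ≤ r
  upd : ∀ r i, a ≤ r → r < k → i ≤ r → L' r i = L r i + if i = σ r then 1 else 0
  blk0 : ∀ b i, a = b + 1 → i < σ a → L a i = L b i
  lt : ∀ r, a ≤ r → r + 1 < k → σ r < σ (r+1)
  blk : ∀ r i, a ≤ r → r + 1 < k → σ r < i → i < σ (r+1) → L (r+1) i = L r i
  free : ∀ r, a ≤ r + 1 → r + 1 < k → σ (r+1) ≤ r → L (r+1) (σ (r+1)) < L r (σ (r+1))

theorem Ins.gtp {k a σ L L'} (h : Ins k a σ L L') (hL : GTP k L) : GTP k L' := by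
  refine ⟨?_, ?_, ?_⟩
  · intro r i hi hr
    have := hL.nonneg r i hi hr
    rcases lt_or_ge r a with h1 | h1
    · rw [h.below r i h1 hi]; exact this
    · rw [h.upd r i h1 hr hi]; split_ifs <;> omega
  · intro r i hi hr
    have h0 := hL.le1 r i hi hr
    rcases lt_or_ge (r+1) a with h1 | h1
    · rw [h.below r i (by omega) hi, h.below (r+1) i h1 (by omega)]; exact h0
    · have hf := h.free r h1 hr
      rw [h.upd (r+1) i h1 hr (by omega)]
      have h3 : L r i ≤ L' r i := by
        rcases lt_or_ge r a with h2 | h2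
        · rw [h.below r i h2 hi]
        · rw [h.upd r i h2 (by omega) hi]; split_ifs <;> omega
      split_ifs with h4
      · subst h4
        have := hf hi
        omega
      · omega
  · intro r i hi hr
    have h0 := hL.le2 r i hi hr
    rcases lt_or_ge r a with h1 | h1
    · rw [h.below r i h1 hi]
      rcases lt_or_ge (r+1) a with h2 | h2
      · rw [h.below _ _ h2 (by omega)]; exact h0
      · rw [h.upd _ _ h2 hr (by omega)]; split_ifs <;> omega
    · rw [h.upd r i h1 (by omega) hi, h.upd (r+1) (i+1) (by omega) hr (by omega)]
      by_cases h4 : i = σ r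
      · by_cases h5 : i + 1 = σ (r+1)
        · simp [h4, ← h5]; simp [← h4]; exact h0
        · have h6 := h.lt r h1 hr
          have h7 := h.hσ (r+1) (by omega) hr
          have h8 := h.blk r (i+1) h1 hr (by omega) (by omega)
          rcases r with _ | r
          · omega
          · have h9 := h.free r h1 (by omega) (by omega)
            have h10 := hL.le2 r i (by omega) (by omega)
            rw [← h4] at h9
            simp only [h4.symm, h5, if_true, if_false]
            omega
      · simp only [h4, if_false]; split_ifs <;> omega

theorem next_exists {k L} (hL : GTP k L) (r s : ℕ) : r + 1 < k → s ≤ r + 1 →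
    ∃ t, s ≤ t ∧ t ≤ r + 1 ∧ (∀ i, s ≤ i → i < t → L (r+1) i = L r i) ∧
      (t ≤ r → L (r+1) t < L r t) := by
  intro hr hs
  classical
  have hex : ∃ t, s ≤ t ∧ (t = r + 1 ∨ L (r+1) t ≠ L r t) := ⟨r+1, hs, Or.inl rfl⟩
  have hle : Nat.find hex ≤ r + 1 := Nat.find_min' hex ⟨hs, Or.inl rfl⟩
  refine ⟨Nat.find hex, (Nat.find_spec hex).1, hle, ?_, ?_⟩
  · intro i h1 h2
    have := Nat.find_min hex h2
    by_contra h3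
    exact this ⟨h1, Or.inr h3⟩
  · intro h1
    rcases (Nat.find_spec hex).2 with h2 | h2
    · omega
    · exact lt_of_le_of_ne (hL.le1 r _ h1 hr) h2

theorem Ins.exists_fwd {k a L} (hL : GTP k L) (ha : a < k) : ∃ σ L', Ins k a σ L L' := by
  have := next_exists hL
  choose! f hf using this
  let σ : ℕ → ℕ := fun r => Nat.rec 0 (fun r s => if r + 1 = a then f r 0 else f r (s+1)) r
  have σs : ∀ r, σ (r+1) = if r + 1 = a then f r 0 else f r (σ r + 1) := fun r => rfl
  have σ0 : σ 0 = 0 := rfl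
  clear_value σ
  have hσ : ∀ r, a ≤ r → r < k → σ r ≤ r := by
    intro r h1
    induction r with
    | zero => intro _; omega
    | succ r ih =>
      intro h2
      rw [σs]
      split_ifs with h3
      · exact (hf r 0 h2 (by omega)).2.1
      · exact (hf r _ h2 (by have := ih (by omega) (by omega); omega)).2.1
  refine ⟨σ, fun r i => if r < a then L r i else L r i + if i = σ r then 1 else 0, ha, ?_, hσ, ?_, ?_, ?_, ?_, ?_⟩
  · intro r i h1 h2; simp [h1]
  · intro r i h1 h2 h3; simp [not_lt.2 h1]
  · intro b i h1 h2
    subst h1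
    rw [σs, if_pos rfl] at h2
    exact (hf b 0 ha (by omega)).2.2.1 i (by omega) h2
  · intro r h1 h2
    have := hf r (σ r + 1) h2 (by have := hσ r h1 (by omega); omega)
    rw [σs, if_neg (by omega)]
    omega
  · intro r i h1 h2 h3 h4
    have := hf r (σ r + 1) h2 (by have := hσ r h1 (by omega); omega)
    rw [σs, if_neg (by omega)] at h4
    exact this.2.2.1 i h3 h4
  · intro r h1 h2 h3
    rw [σs] at h3 ⊢
    split_ifs at h3 ⊢ with h4
    · exact (hf r 0 h2 (by omega)).2.2.2 h3
    · exact (hf r (σ r + 1) h2 (by have := hσ r (by omega) (by omega); omega)).2.2.2 h3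

theorem Ins.exists_back (k : ℕ) : ∀ L', GTP k L' → ∀ l r, r + 1 = k → l ≤ r →
    (l = 0 → 0 < L' r 0) → (∀ j, l = j + 1 → L' r j < L' r l) →
    ∃ a σ L, GTP k L ∧ Ins k a σ L L' ∧ σ r = l := by
  induction k with
  | zero => intro L' _ l r h; omega
  | succ k ih =>
    intro L' hL' l r hr hl h0 hj
    obtain rfl : r = k := by omega
    classical
    by_cases hA : ∀ i, i < l → ∀ b, r = b + 1 → L' b i = L' r i
    ·
      refine ⟨r, fun _ => l, fun q i => L' q i - if q = r ∧ i = l then 1 else 0, ?_, ?_, rfl⟩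
      · refine ⟨?_, ?_, ?_⟩
        · intro q i h1 h2
          have := hL'.nonneg q i h1 h2
          split_ifs with h3
          · obtain ⟨rfl, rfl⟩ := h3
            rcases i with _ | i
            · have := h0 rfl; omega
            · have := hj i rfl
              have := hL'.nonneg q i (by omega) h2
              omega
          · omega
        · intro q i h1 h2
          have := hL'.le1 q i h1 h2
          have hq : q ≠ r := by omega
          simp only [hq, false_and, if_false]
          split_ifs <;> omega
        · intro q i h1 h2
          have := hL'.le2 q i h1 h2
          have hq : q ≠ r := by omega
          simp only [hq, false_and, if_false]
          split_ifs with h3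
          · obtain ⟨h3, rfl⟩ := h3
            have h4 := hA i (by omega) q h3.symm
            have := hj i rfl
            rw [h3]
            omega
          · omega
      · refine ⟨by omega, ?_, ?_, ?_, ?_, ?_, ?_, ?_⟩
        · intro q i h1 h2
          have hq : q ≠ r := by omega
          simp [hq]
        · intros; omega
        · intro q i h1 h2 h3
          obtain rfl : q = r := by omega
          simp
        · intro b i h1 h2
          have := hA i h2 b h1
          have hq : b ≠ r := by omega
          have hi : i ≠ l := by omega
          simp [hq, hi, this]
        · intros; omega
        · intros; omega
        · intro q h1 h2 h3
          obtain rfl : q + 1 = r := by omega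
          have := hL'.le1 q l h3 (by omega)
          simp
          omega
    · push Not at hA
      obtain ⟨i0, hi0, b, rfl, hne0⟩ := hA
      have hex : ∃ d, d < l ∧ L' b (l - 1 - d) ≠ L' (b+1) (l - 1 - d) :=
        ⟨l - 1 - i0, by omega, by rw [show l - 1 - (l - 1 - i0) = i0 by omega]; exact hne0⟩
      obtain ⟨i, hil, hne, heq⟩ : ∃ i, i < l ∧ L' b i ≠ L' (b+1) i ∧
          ∀ j, i < j → j < l → L' b j = L' (b+1) j := by
        refine ⟨l - 1 - Nat.find hex, by omega, (Nat.find_spec hex).2, ?_⟩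
        intro j h1 h2
        have := Nat.find_min hex (m := l - 1 - j) (by omega)
        by_contra h3
        apply this
        refine ⟨by omega, ?_⟩
        rw [show l - 1 - (l - 1 - j) = j by omega]
        exact h3
      have hlt : L' (b+1) i < L' b i :=
        lt_of_le_of_ne (hL'.le1 b i (by omega) (by omega)) (Ne.symm hne)
      have hL'' : GTP (b+1) L' := ⟨fun r i h1 h2 => hL'.nonneg r i h1 (by omega),
        fun r i h1 h2 => hL'.le1 r i h1 (by omega), fun r i h1 h2 => hL'.le2 r i h1 (by omega)⟩
      obtain ⟨a, σ, L, hL, hI, hσ⟩ := ih L' hL'' i b rfl (by omega)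
        (by rintro rfl; have := hL'.nonneg (b+1) 0 (by omega) (by omega); omega)
        (by rintro j rfl
            have := hL'.le2 b j (by omega) (by omega)
            omega)
      have ha := hI.ha
      have hrow : ∀ j, j ≤ b → L b j = L' b j - if j = i then 1 else 0 := by
        intro j hj
        have := hI.upd b j (by omega) (by omega) hj
        rw [hσ] at this
        omega
      refine ⟨a, fun q => if q = b + 1 then l else σ q,
        fun q j => if q = b + 1 then L' q j - (if j = l then 1 else 0) else L q j, ?_, ?_, by simp⟩
      · refine ⟨?_, ?_, ?_⟩
        · intro q j h1 h2
          by_cases hq : q = b + 1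
          · subst hq
            have := hL'.nonneg (b+1) j h1 h2
            simp only [if_true]
            split_ifs with h3
            · subst h3
              rcases j with _ | j
              · omega
              · have := hj j rfl
                have := hL'.nonneg (b+1) j (by omega) h2
                omega
            · omega
          · simp only [hq, if_false]
            exact hL.nonneg q j h1 (by omega)
        · intro q j h1 h2
          by_cases hq : q = b
          · subst hq
            have := hL'.le1 q j h1 h2
            simp only [if_true, show q ≠ q + 1 by omega, if_false]
            rw [hrow j h1]
            by_cases hji : j = i
            · subst hji
              split_ifs <;> omega
            · split_ifs <;> omega
          · simp only [show q + 1 ≠ b + 1 by omega, show q ≠ b + 1 by omega, if_false]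
            exact hL.le1 q j h1 (by omega)
        · intro q j h1 h2
          by_cases hq : q = b
          · subst hq
            have := hL'.le2 q j h1 h2
            simp only [if_true, show q ≠ q + 1 by omega, if_false]
            rw [hrow j h1]
            by_cases hji : j = i
            · subst hji
              split_ifs <;> omega
            · simp only [hji, if_false]
              split_ifs with h3
              · have h4 := heq j (by omega) (by omega)
                have h5 := hj j h3.symm
                subst h3
                omega
              · omega
          · simp only [show q + 1 ≠ b + 1 by omega, show q ≠ b + 1 by omega, if_false]
            exact hL.le2 q j h1 (by omega)
      · refine ⟨by omega, ?_, ?_, ?_, ?_, ?_, ?_, ?_⟩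
        · intro q j h1 h2
          simp only [show q ≠ b + 1 by omega, if_false]
          exact hI.below q j h1 h2
        · intro q h1 h2
          split_ifs with h3
          · omega
          · exact hI.hσ q h1 (by omega)
        · intro q j h1 h2 h3
          by_cases hq : q = b + 1
          · simp [hq]
          · simp only [hq, if_false]
            exact hI.upd q j h1 (by omega) h3
        · intro c j h1 h2
          simp only [show a ≠ b + 1 by omega, show c ≠ b + 1 by omega, if_false] at h2 ⊢
          exact hI.blk0 c j h1 h2
        · intro q h1 h2
          by_cases hq : q = b
          · subst hq; simp; omega
          · simp only [show q + 1 ≠ b + 1 by omega, show q ≠ b + 1 by omega, if_false]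
            exact hI.lt q h1 (by omega)
        · intro q j h1 h2 h3 h4
          by_cases hq : q = b
          · subst hq
            simp only [if_true, show q ≠ q + 1 by omega, if_false] at h3 h4 ⊢
            rw [hrow j (by omega), heq j (by omega) h4, if_neg (by omega), if_neg (by omega)]
          · simp only [show q + 1 ≠ b + 1 by omega, show q ≠ b + 1 by omega, if_false] at h3 h4 ⊢
            exact hI.blk q j h1 (by omega) h3 h4
        · intro q h1 h2 h3
          by_cases hq : q = b
          · subst hq
            simp only [if_true, show q ≠ q + 1 by omega, if_false] at h3 ⊢
            rw [hrow l h3, if_neg (by omega)]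
            have := hL'.le1 q l h3 h2
            omega
          · simp only [show q + 1 ≠ b + 1 by omega, show q ≠ b + 1 by omega, if_false] at h3 ⊢
            exact hI.free q h1 (by omega) h3

theorem Ins.gt_below {k a σ L L'} (h : Ins k a σ L L') (hL : GTP k L) (r : ℕ) (h1 : a ≤ r)
    (h2 : r + 1 < k) : L' (r+1) (σ r) < L' r (σ r) := by
  have h3 := h.hσ r h1 (by omega)
  have h4 := h.lt r h1 h2
  rw [h.upd r _ h1 (by omega) h3, h.upd (r+1) _ (by omega) h2 (by omega), if_pos rfl,
    if_neg (by omega)]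
  have := hL.le1 r _ h3 h2
  omega

theorem Ins.eq_between {k a σ L L'} (h : Ins k a σ L L') (r i : ℕ) (h1 : a ≤ r)
    (h2 : r + 1 < k) (h3 : σ r < i) (h4 : i < σ (r+1)) : L' (r+1) i = L' r i := by
  have h5 := h.hσ (r+1) (by omega) h2
  rw [h.upd r _ h1 (by omega) (by omega), h.upd (r+1) _ (by omega) h2 (by omega),
    if_neg (by omega), if_neg (by omega), h.blk r i h1 h2 h3 h4]

theorem Ins.eq_start {k σ L L'} (r i : ℕ) (h : Ins k (r+1) σ L L')
    (h4 : i < σ (r+1)) : L' (r+1) i = L' r i := by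
  have h5 := h.hσ (r+1) (by omega) h.ha
  rw [h.below r _ (by omega) (by omega), h.upd (r+1) _ (by omega) h.ha (by omega),
    if_neg (by omega), h.blk0 r i rfl h4, add_zero]

theorem Ins.back_aux {k a b σ τ L M L'} (h : Ins k a σ L L') (h' : Ins k b τ M L')
    (hL : GTP k L) (hM : GTP k M) (r : ℕ) (hr : r + 1 < k) (ha : a ≤ r) (hb : b ≤ r + 1)
    (hs : σ (r+1) = τ (r+1)) : b ≤ r ∧ τ r ≤ σ r → b ≤ r ∧ τ r = σ r := by
  rintro ⟨h1, h2⟩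
  refine ⟨h1, ?_⟩
  by_contra h3
  have h4 := h'.eq_between r (σ r) h1 hr (by omega) (by rw [← hs]; exact h.lt r ha hr)
  have h5 := h.gt_below hL r ha hr
  omega

theorem Ins.back_le {k a b σ τ L M L'} (h : Ins k a σ L L') (h' : Ins k b τ M L')
    (hL : GTP k L) (r : ℕ) (hr : r + 1 < k) (ha : a ≤ r) (hb : b ≤ r + 1)
    (hs : σ (r+1) = τ (r+1)) : b ≤ r := by
  by_contra h3
  obtain rfl : b = r + 1 := by omega
  have h4 := Ins.eq_start r (σ r) h' (by rw [← hs]; exact h.lt r ha hr)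
  have h5 := h.gt_below hL r ha hr
  omega

theorem Ins.back_unique {k a b σ τ L M L'} (h : Ins k a σ L L') (h' : Ins k b τ M L')
    (hL : GTP k L) (hM : GTP k M) (hs : σ (k-1) = τ (k-1)) :
    a = b ∧ ∀ r i, i ≤ r → r < k → L r i = M r i := by
  have hak := h.ha
  have hbk := h'.ha
  have key : ∀ d r, r + d + 1 = k → (a ≤ r ↔ b ≤ r) ∧ (a ≤ r → σ r = τ r) := by
    intro d
    induction d with
    | zero =>
      intro r hr
      obtain rfl : r = k - 1 := by omega
      exact ⟨by constructor <;> intro <;> omega, fun _ => hs⟩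
    | succ d ih =>
      intro r hr
      obtain ⟨h1, h2⟩ := ih (r+1) (by omega)
      have hiff : a ≤ r ↔ b ≤ r := by
        constructor
        · intro h3
          exact h.back_le h' hL r (by omega) h3 (h1.1 (by omega)) (h2 (by omega))
        · intro h3
          exact h'.back_le h hM r (by omega) h3 (h1.2 (by omega)) (h2 (by omega)).symm
      refine ⟨hiff, ?_⟩
      intro h3
      have h4 := hiff.1 h3
      have h5 := h2 (by omega)
      rcases le_total (τ r) (σ r) with h6 | h6
      · exact (h.back_aux h' hL hM r (by omega) h3 (by omega) h5 ⟨h4, h6⟩).2.symm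
      · exact (h'.back_aux h hM hL r (by omega) h4 (by omega) h5.symm ⟨h3, h6⟩).2
  have hab : a = b := by
    have h1 := (key (k - 1 - a) a (by omega)).1
    have h2 := (key (k - 1 - b) b (by omega)).1
    omega
  refine ⟨hab, ?_⟩
  subst hab
  intro r i hi hr
  rcases lt_or_ge r a with h1 | h1
  · rw [← h.below r i h1 hi, h'.below r i h1 hi]
  · have h2 := h.upd r i h1 hr hi
    have h3 := h'.upd r i h1 hr hi
    rw [(key (k - 1 - r) r (by omega)).2 h1] at h2
    omega

theorem minOp_zero (x y : ℕ → ℤ) : minOp x y 0 = x 0 := by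
  simp [minOp]

theorem minOp_succ (x y : ℕ → ℤ) (m : ℕ) :
    minOp x y (m+1) = min (minOp x y m + (y (m+1) - y m)) (x (m+1)) := by
  unfold minOp
  apply le_antisymm
  · apply le_min
    · rw [← sub_le_iff_le_add]
      apply Finset.le_inf'
      intro j hj
      have : Finset.inf' (Finset.range (m+1+1)) (by simp) (fun j => x j + y (m+1) - y j)
          ≤ x j + y (m+1) - y j := Finset.inf'_le (fun j => x j + y (m+1) - y j)
        (by simp at hj ⊢; omega)
      omega
    · have : Finset.inf' (Finset.range (m+1+1)) (by simp) (fun j => x j + y (m+1) - y j)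
          ≤ x (m+1) + y (m+1) - y (m+1) := Finset.inf'_le (fun j => x j + y (m+1) - y j)
        (by simp)
      omega
  · apply Finset.le_inf'
    intro j hj
    by_cases h : j = m + 1
    · subst h
      exact (min_le_right _ _).trans (by omega)
    · have : Finset.inf' (Finset.range (m+1)) (by simp) (fun j => x j + y m - y j)
          ≤ x j + y m - y j := Finset.inf'_le (fun j => x j + y m - y j)
        (by simp at hj ⊢; omega)
      exact (min_le_left _ _).trans (by omega)

theorem maxOp_eq (x y : ℕ → ℤ) (m : ℕ) : maxOp x y m = x m + y m - minOp y x m := by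
  unfold maxOp minOp
  apply le_antisymm
  · apply Finset.sup'_le
    intro j hj
    have : Finset.inf' (Finset.range (m+1)) (by simp) (fun j => y j + x m - x j)
          ≤ y j + x m - x j := Finset.inf'_le (fun j => y j + x m - x j) hj
    omega
  · obtain ⟨j, hj, he⟩ := Finset.exists_mem_eq_inf' (s := Finset.range (m+1)) (by simp)
      (fun j => y j + x m - x j)
    rw [he]
    have : x j + y m - y j ≤ Finset.sup' (Finset.range (m+1)) (by simp)
      (fun j => x j + y m - y j) := Finset.le_sup' (fun j => x j + y m - y j) hj
    omega

/-- iterated `Tseq` -/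
noncomputable def Yit (x : ℕ → ℕ → ℤ) : ℕ → (ℕ → ℕ → ℤ)
  | 0 => x
  | l+1 => Tseq (Yit x l)

theorem Yit_succ' (x : ℕ → ℕ → ℤ) (l : ℕ) : Yit x (l+1) = Yit (Tseq x) l := by
  induction l with
  | zero => rfl
  | succ l ih => rw [Yit, ih, Yit]

theorem G_eq (k : ℕ) : ∀ x i, i < k → G k x i = Dseq (Yit x i) (k - 1 - i) := by
  induction k with
  | zero => intro x i h; omega
  | succ k ih =>
    intro x i h
    rcases k with _ | k
    · obtain rfl : i = 0 := by omega
      rfl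
    · rcases i with _ | i
      · rfl
      · rw [Yit_succ']
        have : G (k+1+1) x (i+1) = G (k+1) (Tseq x) i := rfl
        rw [this, ih _ _ (by omega)]
        congr 1
        omega

theorem Tseq_eq (x : ℕ → ℕ → ℤ) (i m : ℕ) :
    Tseq x i m = x (i+1) m + Dseq x i m - Dseq x (i+1) m := by
  rw [Tseq, maxOp_eq]; rfl

theorem Dseq_zero_time (x : ℕ → ℕ → ℤ) (h : ∀ i, x i 0 = 0) (i : ℕ) : Dseq x i 0 = 0 := by
  induction i with
  | zero => exact h 0
  | succ i ih => rw [Dseq, minOp_zero, ih]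

theorem Yit_zero_time (x : ℕ → ℕ → ℤ) (h : ∀ i, x i 0 = 0) (l : ℕ) :
    ∀ i, Yit x l i 0 = 0 := by
  induction l with
  | zero => exact h
  | succ l ih =>
    intro i
    rw [Yit, Tseq_eq, ih, Dseq_zero_time _ ih, Dseq_zero_time _ ih]; rfl

theorem step_char (k a : ℕ) (σ : ℕ → ℕ) (L L' : ℕ → ℕ → ℤ) (hI : Ins k a σ L L')
    (hL : GTP k L) (x : ℕ → ℕ → ℤ) (m : ℕ)
    (hx : ∀ q, x q (m+1) = x q m + if q = a then 1 else 0)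
    (hD : ∀ l q, q + l < k → Dseq (Yit x l) q m = L (q+l) l) (l : ℕ) :
    (∀ q, q + l < k → Yit x l q (m+1) = Yit x l q m +
      if a ≤ q + l ∧ (q + l = a ∨ σ (q + l - 1) < l) ∧ l ≤ σ (q+l) then 1 else 0) ∧
    (∀ q, q + l < k → Dseq (Yit x l) q (m+1) = L' (q+l) l) := by
  have hL' := hI.gtp hL
  have hYD : ∀ l, (∀ q, q + l < k → Yit x l q (m+1) = Yit x l q m +
      if a ≤ q + l ∧ (q + l = a ∨ σ (q + l - 1) < l) ∧ l ≤ σ (q+l) then 1 else 0) →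
      (∀ q, q + l < k → Dseq (Yit x l) q (m+1) = L' (q+l) l) := by
    intro l hY q
    induction q with
    | zero =>
      intro hq
      have h1 := hY 0 hq
      have h2 := hD l 0 hq
      change Yit x l 0 m = _ at h2
      change Yit x l 0 (m+1) = _
      rw [h1, h2]
      simp only [zero_add] at *
      rcases lt_or_ge l a with h3 | h3
      · rw [hI.below l l h3 le_rfl, if_neg (by omega), add_zero]
      · rw [hI.upd l l h3 hq le_rfl]
        congr 1
        have h4 := hI.hσ l h3 hq
        by_cases h5 : l = σ l
        · rw [if_pos h5, if_pos]
          refine ⟨h3, ?_, by omega⟩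
          by_contra h6
          push Not at h6
          obtain ⟨h6, h7⟩ := h6
          have h8 := hI.lt (l-1) (by omega) (by omega)
          rw [show l - 1 + 1 = l by omega] at h8
          omega
        · rw [if_neg h5, if_neg (by omega)]
    | succ q ih =>
      intro hq
      have h1 := hY (q+1) hq
      have h2 := hD l (q+1) hq
      have h3 := ih (by omega)
      rw [Dseq, minOp_succ, h1, h3]
      rw [Dseq] at h2
      rw [h2]
      have h4 := hL'.le1 (q+l) l (by omega) (by omega)
      rw [show q + 1 + l = q + l + 1 by omega] at *
      generalize hr : q + l = r at *
      have hlr : l ≤ r := by omega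
      simp only [Nat.add_sub_cancel]
      rcases lt_or_ge (r+1) a with h5 | h5
      · rw [if_neg (by omega)]
        rw [hI.below (r+1) l h5 (by omega)] at h4 ⊢
        rw [min_eq_left (by omega)]; omega
      · have h6 := hI.upd (r+1) l h5 hq (by omega)
        by_cases h7 : l = σ (r+1)
        · rw [if_pos h7] at h6
          rw [if_pos, min_eq_left (by omega)]
          · omega
          · refine ⟨h5, ?_, by omega⟩
            by_contra h8
            have := hI.lt r (by omega) hq
            omega
        · rw [if_neg h7, add_zero] at h6
          split_ifs with h8
          · rw [h6, min_eq_right]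
            · obtain ⟨_, h9, h10⟩ := h8
              rw [← h6]
              rcases h9 with h9 | h9
              · subst h9
                exact (Ins.eq_start r l hI (by omega)).symm
              · by_cases h11 : a = r + 1
                · subst h11
                  exact (Ins.eq_start r l hI (by omega)).symm
                · exact (hI.eq_between r l (by omega) hq h9 (by omega)).symm
            · obtain ⟨_, h9, h10⟩ := h8
              have : L' (r+1) l = L' r l := by
                by_cases h11 : a = r + 1
                · subst h11
                  exact (Ins.eq_start r l hI (by omega))
                · exact (hI.eq_between r l (by omega) hq (by omega) (by omega))
              omega
          · rw [h6, min_eq_left (by omega)]; omega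
  have hY : ∀ l, (∀ q, q + l < k → Yit x l q (m+1) = Yit x l q m +
      if a ≤ q + l ∧ (q + l = a ∨ σ (q + l - 1) < l) ∧ l ≤ σ (q+l) then 1 else 0) := by
    intro l
    induction l with
    | zero =>
      intro q hq
      have := hx q
      simp only [Yit, add_zero, Nat.not_lt_zero, or_false, Nat.zero_le, and_true]
      rw [this]
      congr 1
      by_cases h : q = a
      · simp [h]
      · simp [h]
    | succ l ih =>
      intro q hq
      have hD' := hYD l ih
      rw [Yit, Tseq_eq, Tseq_eq, hD' q (by omega), hD' (q+1) (by omega), hD l q (by omega),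
        hD l (q+1) (by omega), ih (q+1) (by omega)]
      rw [show q + 1 + l = q + l + 1 by omega, show q + (l + 1) = q + l + 1 by omega] at *
      generalize hr : q + l = r at *
      have hlr : l ≤ r := by omega
      simp only [Nat.add_sub_cancel]
      rcases lt_or_ge (r+1) a with h5 | h5
      · rw [hI.below (r+1) l h5 (by omega), hI.below r l (by omega) (by omega),
          if_neg (by omega), if_neg (by omega)]
        omega
      · rw [hI.upd (r+1) l h5 hq (by omega)]
        rcases lt_or_ge r a with h6 | h6
        · rw [hI.below r l (by omega) (by omega)]
          split_ifs <;> omega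
        · rw [hI.upd r l h6 (by omega) hlr]
          have := hI.lt r h6 hq
          split_ifs <;> omega
  exact ⟨hY l, hYD l (hY l)⟩

/-- A chain of patterns obtained by inserting the letters `u 0, …, u (n-1)`. -/
structure Chain (k n : ℕ) (u : ℕ → ℕ) (P : ℕ → ℕ → ℕ → ℤ) : Prop where
  zero : ∀ r i, i ≤ r → r < k → P 0 r i = 0
  gtp : ∀ m ≤ n, GTP k (P m)
  ins : ∀ m, m < n → ∃ σ, Ins k (u m) σ (P m) (P (m+1))

/-- counting walk of a word -/
def wcnt (u : ℕ → ℕ) (i n : ℕ) : ℤ := ((((Finset.range n).filter (fun m => u m = i))).card : ℤ)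

theorem wcnt_succ (u : ℕ → ℕ) (i n : ℕ) :
    wcnt u i (n+1) = wcnt u i n + if i = u n then 1 else 0 := by
  unfold wcnt
  rw [Finset.range_add_one, Finset.filter_insert]
  by_cases h : u n = i
  · simp [h]
  · simp [h, Ne.symm h]

theorem Chain.char {k n u P} (h : Chain k n u P) : ∀ m ≤ n, ∀ l q, q + l < k →
    Dseq (Yit (wcnt u) l) q m = P m (q+l) l := by
  intro m
  induction m with
  | zero =>
    intro _ l q hq
    rw [h.zero _ _ (by omega) hq]
    apply Dseq_zero_time
    apply Yit_zero_time
    intro i; simp [wcnt]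
  | succ m ih =>
    intro hm l
    obtain ⟨σ, hI⟩ := h.ins m (by omega)
    exact (step_char k (u m) σ _ _ hI (h.gtp m (by omega)) (wcnt u) m
      (fun q => wcnt_succ u q m) (ih (by omega)) l).2

theorem Chain.G_eq {k n u P} (h : Chain k n u P) (m : ℕ) (hm : m ≤ n) (i : ℕ) (hi : i < k) :
    G k (wcnt u) i m = P m (k-1) i := by
  rw [_root_.G_eq k _ i hi, h.char m hm _ _ (by omega)]
  congr 1
  omega

theorem Chain.exists_fwd {k : ℕ} (n : ℕ) (u : ℕ → ℕ) (hu : ∀ m < n, u m < k) :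
    ∃ P, Chain k n u P := by
  induction n with
  | zero =>
    exact ⟨fun _ _ _ => 0, by simp, fun _ _ => ⟨by simp, by simp, by simp⟩, by simp⟩
  | succ n ih =>
    obtain ⟨P, hP⟩ := ih (fun m hm => hu m (by omega))
    obtain ⟨σ, L', hI⟩ := Ins.exists_fwd (hP.gtp n le_rfl) (hu n (by omega))
    refine ⟨fun m => if m = n + 1 then L' else P m, ?_, ?_, ?_⟩
    · simpa using hP.zero
    · intro m hm
      by_cases h : m = n + 1
      · simp only [h, if_true]
        exact hI.gtp (hP.gtp n le_rfl)
      · simp only [h, if_false]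
        exact hP.gtp m (by omega)
    · intro m hm
      by_cases h : m = n
      · subst h
        simp only [show m ≠ m + 1 by omega, if_true, if_false]
        exact ⟨σ, hI⟩
      · simp only [show m ≠ n + 1 by omega, show m + 1 ≠ n + 1 by omega, if_false]
        exact hP.ins m (by omega)

/-- an admissible path in the Weyl chamber -/
structure WPath (k n : ℕ) (g : ℕ → ℕ → ℤ) : Prop where
  zero : ∀ i, i < k → g i 0 = 0
  step : ∀ m, m < n → ∃ j, j < k ∧ g j (m+1) = g j m + 1 ∧
    ∀ i, i < k → i ≠ j → g i (m+1) = g i m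
  mono : ∀ m ≤ n, ∀ i, i + 1 < k → g i m ≤ g (i+1) m

theorem WPath.nonneg {k n g} (h : WPath k n g) : ∀ m ≤ n, ∀ i, i < k → 0 ≤ g i m := by
  intro m
  induction m with
  | zero => intro _ i hi; rw [h.zero i hi]
  | succ m ih =>
    intro hm i hi
    have h1 := ih (by omega) i hi
    obtain ⟨j, hj, h2, h3⟩ := h.step m (by omega)
    by_cases hij : i = j
    · subst hij; omega
    · rw [h3 i hi hij]; exact h1

theorem GTP.congr {k L M} (hL : GTP k L) (h : ∀ r i, i ≤ r → r < k → L r i = M r i) :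
    GTP k M := by
  refine ⟨?_, ?_, ?_⟩
  · intro r i h1 h2; rw [← h r i h1 h2]; exact hL.nonneg r i h1 h2
  · intro r i h1 h2
    rw [← h r i h1 (by omega), ← h (r+1) i (by omega) (by omega)]
    exact hL.le1 r i h1 h2
  · intro r i h1 h2
    rw [← h r i h1 (by omega), ← h (r+1) (i+1) (by omega) (by omega)]
    exact hL.le2 r i h1 h2

theorem GTP.bounds {k L} (hL : GTP k L) (hz : ∀ i, i < k → L (k-1) i = 0) :
    ∀ d r i, r + d + 1 = k → i ≤ r → L r i = 0 := by
  intro d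
  induction d with
  | zero =>
    intro r i h1 h2
    obtain rfl : r = k - 1 := by omega
    exact hz i (by omega)
  | succ d ih =>
    intro r i h1 h2
    have h3 := ih (r+1) i (by omega) (by omega)
    have h4 := ih (r+1) (i+1) (by omega) (by omega)
    have h5 := hL.le1 r i h2 (by omega)
    have h6 := hL.le2 r i h2 (by omega)
    omega

theorem Chain.exists_back {k : ℕ} (hk : 0 < k) (g : ℕ → ℕ → ℤ) (n : ℕ) : WPath k n g →
    ∀ L, GTP k L → (∀ i, i < k → L (k-1) i = g i n) →
    ∃ u P, Chain k n u P ∧ (∀ m, u m < k) ∧ P n = L ∧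
      ∀ m ≤ n, ∀ i, i < k → P m (k-1) i = g i m := by
  induction n with
  | zero =>
    intro hg L hL htop
    refine ⟨fun _ => 0, fun _ => L, ⟨?_, fun _ _ => hL, by simp⟩, fun _ => hk, rfl, ?_⟩
    · intro r i hi hr
      exact hL.bounds (fun i hi => by rw [htop i hi, hg.zero i hi]) (k - 1 - r) r i (by omega) hi
    · intro m hm i hi
      obtain rfl : m = 0 := by omega
      exact htop i hi
  | succ n ih =>
    intro hg L hL htop
    obtain ⟨j, hj, h1, h2⟩ := hg.step n (by omega)
    obtain ⟨a, σ, M, hM, hI, hσ⟩ := Ins.exists_back k L hL j (k-1) (by omega) (by omega)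
      (by
        rintro rfl
        rw [htop 0 hj, h1]
        have := hg.nonneg n (by omega) 0 hj
        omega)
      (by
        rintro i rfl
        rw [htop i (by omega), htop (i+1) hj, h1, h2 i (by omega) (by omega)]
        have := hg.mono n (by omega) i hj
        omega)
    have hak := hI.ha
    have hMtop : ∀ i, i < k → M (k-1) i = g i n := by
      intro i hi
      have h3 := hI.upd (k-1) i (by omega) (by omega) (by omega)
      rw [htop i hi, hσ] at h3
      by_cases hij : i = j
      · subst hij
        rw [if_pos rfl] at h3; omega
      · rw [if_neg hij, h2 i hi hij] at h3; omega
    obtain ⟨u, P, hP, hu, hPn, hPt⟩ := ih ⟨hg.zero, fun m hm => hg.step m (by omega),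
      fun m hm => hg.mono m (by omega)⟩ M hM hMtop
    refine ⟨fun m => if m = n then a else u m, fun m => if m = n + 1 then L else P m,
      ⟨?_, ?_, ?_⟩, ?_, by simp, ?_⟩
    · simpa using hP.zero
    · intro m hm
      by_cases h : m = n + 1
      · simpa only [h, if_true] using hL
      · simp only [h, if_false]
        exact hP.gtp m (by omega)
    · intro m hm
      by_cases h : m = n
      · subst h
        simp only [show m ≠ m + 1 by omega, if_true, if_false]
        exact ⟨σ, by rw [hPn]; exact hI⟩
      · simp only [h, show m ≠ n + 1 by omega, show m + 1 ≠ n + 1 by omega, if_false]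
        exact hP.ins m (by omega)
    · intro m
      show (if m = n then a else u m) < k
      split_ifs
      · exact hI.ha
      · exact hu m
    · intro m hm i hi
      by_cases h : m = n + 1
      · subst h
        simpa using htop i hi
      · simp only [h, if_false]
        exact hPt m (by omega) i hi

theorem Ins.congr {k a σ L L' M} (h : Ins k a σ L L')
    (hM : ∀ r i, i ≤ r → r < k → L' r i = M r i) : Ins k a σ L M := by
  have ha := h.ha
  refine ⟨h.ha, ?_, h.hσ, ?_, h.blk0, h.lt, h.blk, h.free⟩
  · intro r i h1 h2
    rw [← hM r i h2 (by omega)]; exact h.below r i h1 h2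
  · intro r i h1 h2 h3
    rw [← hM r i h3 h2]; exact h.upd r i h1 h2 h3

theorem Chain.back_unique {k : ℕ} (g : ℕ → ℕ → ℤ) (n : ℕ) (u v : ℕ → ℕ)
    (P Q : ℕ → ℕ → ℕ → ℤ) : Chain k n u P → Chain k n v Q →
    (∀ m ≤ n, ∀ i, i < k → P m (k-1) i = g i m) →
    (∀ m ≤ n, ∀ i, i < k → Q m (k-1) i = g i m) →
    (∀ r i, i ≤ r → r < k → P n r i = Q n r i) → ∀ m < n, u m = v m := by
  induction n with
  | zero => intro _ _ _ _ _ m hm; omega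
  | succ n ih =>
    intro hP hQ hPt hQt heq
    obtain ⟨σ, hI⟩ := hP.ins n (by omega)
    obtain ⟨τ, hJ⟩ := hQ.ins n (by omega)
    have hJ' := hJ.congr (fun r i h1 h2 => (heq r i h1 h2).symm)
    have hu := hI.ha
    have hv := hJ.ha
    have hστ : σ (k-1) = τ (k-1) := by
      have h0 := hI.hσ (k-1) (by omega) (by omega)
      have h1 := hI.upd (k-1) (σ (k-1)) (by omega) (by omega) h0
      have h2 := hJ.upd (k-1) (σ (k-1)) (by omega) (by omega) h0
      rw [hPt _ (by omega) _ (by omega), hPt _ (by omega) _ (by omega), if_pos rfl] at h1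
      rw [hQt _ (by omega) _ (by omega), hQt _ (by omega) _ (by omega)] at h2
      by_contra h3
      rw [if_neg h3] at h2
      omega
    obtain ⟨h1, h2⟩ := hI.back_unique hJ' (hP.gtp n (by omega)) (hQ.gtp n (by omega)) hστ
    have := ih ⟨hP.zero, fun m hm => hP.gtp m (by omega), fun m hm => hP.ins m (by omega)⟩
      ⟨hQ.zero, fun m hm => hQ.gtp m (by omega), fun m hm => hQ.ins m (by omega)⟩
      (fun m hm => hPt m (by omega)) (fun m hm => hQt m (by omega)) h2
    intro m hm
    by_cases h : m = n
    · rw [h, h1]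
    · exact this m (by omega)

theorem Chain.sum_row {k n u P} (h : Chain k n u P) : ∀ m ≤ n, ∀ r < k,
    ∑ i ∈ Finset.range (r+1), P m r i = ∑ v ∈ Finset.range (r+1), wcnt u v m := by
  intro m
  induction m with
  | zero =>
    intro _ r hr
    rw [Finset.sum_eq_zero, Finset.sum_eq_zero]
    · intro v _; simp [wcnt]
    · intro i hi
      exact h.zero r i (by simp at hi; omega) hr
  | succ m ih =>
    intro hm r hr
    obtain ⟨σ, hI⟩ := h.ins m (by omega)
    simp only [wcnt_succ, Finset.sum_add_distrib, ← ih (by omega) r hr]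
    rw [Finset.sum_ite_eq']
    rcases lt_or_ge r (u m) with h1 | h1
    · rw [if_neg (by simp; omega), add_zero]
      apply Finset.sum_congr rfl
      intro i hi
      exact hI.below r i h1 (by simp at hi; omega)
    · rw [if_pos (by simp; omega)]
      rw [Finset.sum_congr rfl (g := fun i => P m r i + if i = σ r then 1 else 0)
        (fun i hi => hI.upd r i h1 hr (by simp at hi; omega))]
      rw [Finset.sum_add_distrib, Finset.sum_ite_eq',
        if_pos (by have := hI.hσ r h1 hr; simp; omega)]

theorem minOp_local {x y x' y' : ℕ → ℤ} {n : ℕ} (hx : ∀ m ≤ n, x m = x' m)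
    (hy : ∀ m ≤ n, y m = y' m) : ∀ m ≤ n, minOp x y m = minOp x' y' m := by
  intro m
  induction m with
  | zero => intro _; rw [minOp_zero, minOp_zero, hx 0 (by omega)]
  | succ m ih =>
    intro hm
    rw [minOp_succ, minOp_succ, ih (by omega), hx _ hm, hy _ hm, hy m (by omega)]

theorem Dseq_local {x x' : ℕ → ℕ → ℤ} {n : ℕ} (hx : ∀ i, ∀ m ≤ n, x i m = x' i m) (i : ℕ) :
    ∀ m ≤ n, Dseq x i m = Dseq x' i m := by
  induction i with
  | zero => exact hx 0
  | succ i ih => exact minOp_local ih (hx _)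

theorem Yit_local {x x' : ℕ → ℕ → ℤ} {n : ℕ} (hx : ∀ i, ∀ m ≤ n, x i m = x' i m) (l : ℕ) :
    ∀ i, ∀ m ≤ n, Yit x l i m = Yit x' l i m := by
  induction l with
  | zero => exact hx
  | succ l ih =>
    intro i m hm
    rw [Yit, Yit, Tseq_eq, Tseq_eq, ih _ _ hm, Dseq_local ih _ _ hm, Dseq_local ih _ _ hm]

theorem G_local {k : ℕ} {u v : ℕ → ℕ} {n : ℕ} (huv : ∀ m < n, u m = v m) (i : ℕ) (hi : i < k)
    (m : ℕ) (hm : m ≤ n) : G k (wcnt u) i m = G k (wcnt v) i m := by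
  rw [G_eq k _ i hi, G_eq k _ i hi]
  refine Dseq_local (Yit_local ?_ _) _ m hm
  intro i m hm
  unfold wcnt
  congr 2
  apply Finset.filter_congr
  intro j hj
  rw [huv j (by simp at hj; omega)]

theorem mem_iff_lt_card {s : Finset ℕ} (h : ∀ a b, a ≤ b → b ∈ s → a ∈ s) (c : ℕ) :
    c ∈ s ↔ c < s.card := by
  constructor
  · intro hc
    have : Finset.range (c+1) ⊆ s := by
      intro a ha
      exact h a c (by simp at ha; omega) hc
    have := Finset.card_le_card this
    simp at this
    omega
  · intro hc
    by_contra hcs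
    have : s ⊆ Finset.range c := by
      intro a ha
      simp only [Finset.mem_range]
      by_contra hac
      exact hcs (h c a (by omega) ha)
    have := Finset.card_le_card this
    simp at this
    omega

/-- number of entries `≤ r` in row `j` -/
def tabN (lam : ℕ → ℕ) (T : ℕ → ℕ → ℕ) (r j : ℕ) : ℕ :=
  ((Finset.range (lam j)).filter (fun c => T j c ≤ r)).card

/-- Gelfand–Tsetlin pattern of a tableau -/
def pat (lam : ℕ → ℕ) (T : ℕ → ℕ → ℕ) (r i : ℕ) : ℤ := (tabN lam T r (r - i) : ℤ)

theorem IsSSYT.lt_tabN {k lam T} (h : IsSSYT k lam T) {r j c : ℕ} (hc : c < lam j) :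
    T j c ≤ r ↔ c < tabN lam T r j := by
  unfold tabN
  rw [← mem_iff_lt_card]
  · simp [hc]
  · intro a b hab hb
    simp only [Finset.mem_filter, Finset.mem_range] at hb ⊢
    exact ⟨by omega, (h.2.2.1 j a b hab hb.1).trans hb.2⟩

theorem IsSSYT.ge_row {k lam T} (h : IsSSYT k lam T) (hl : ∀ j, lam (j+1) ≤ lam j) :
    ∀ j c, c < lam j → j ≤ T j c := by
  intro j
  induction j with
  | zero => intros; omega
  | succ j ih =>
    intro c hc
    have h1 := ih c (lt_of_lt_of_le hc (hl j))
    have h2 := h.2.2.2 j (j+1) c (by omega) hc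
    omega

theorem IsSSYT.gtp {k lam T} (h : IsSSYT k lam T) (hl : ∀ j, lam (j+1) ≤ lam j) :
    GTP k (pat lam T) := by
  refine ⟨fun r i _ _ => by unfold pat; omega, ?_, ?_⟩
  · intro r i hi hr
    unfold pat tabN
    rw [show r + 1 - i = r - i + 1 by omega]
    generalize r - i = j
    norm_cast
    apply Finset.card_le_card
    intro c hc
    simp only [Finset.mem_filter, Finset.mem_range] at hc ⊢
    have h2 := h.2.2.2 j (j+1) c (by omega) hc.1
    have := hl j
    omega
  · intro r i hi hr
    unfold pat tabN
    rw [show r + 1 - (i + 1) = r - i by omega]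
    norm_cast
    apply Finset.card_le_card
    intro c hc
    simp only [Finset.mem_filter, Finset.mem_range] at hc ⊢
    omega

theorem IsSSYT.pat_top {k lam T} (h : IsSSYT k lam T) (i : ℕ) (hi : i < k) :
    pat lam T (k-1) i = lam (k - 1 - i) := by
  unfold pat tabN
  rw [Finset.filter_true_of_mem, Finset.card_range]
  intro c hc
  have := h.1 (k-1-i) c (by simpa using hc)
  omega

theorem IsSSYT.ext_pat {k lam T T'} (h : IsSSYT k lam T) (h' : IsSSYT k lam T')
    (hl : ∀ j, lam (j+1) ≤ lam j)
    (heq : ∀ r i, i ≤ r → r < k → pat lam T r i = pat lam T' r i) : T = T' := by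
  have key : ∀ S S' : ℕ → ℕ → ℕ, IsSSYT k lam S → IsSSYT k lam S' →
      (∀ r i, i ≤ r → r < k → pat lam S r i = pat lam S' r i) →
      ∀ j c, c < lam j → S' j c ≤ S j c := by
    intro S S' hS hS' he j c hc
    have h1 := hS.1 j c hc
    have h2 := hS.ge_row hl j c hc
    rw [hS'.lt_tabN hc]
    have h3 := (hS.lt_tabN (r := S j c) hc).1 le_rfl
    have h4 := he (S j c) (S j c - j) (by omega) h1
    unfold pat at h4
    rw [show S j c - (S j c - j) = j by omega] at h4
    omega
  funext j c
  by_cases hc : c < lam j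
  · exact le_antisymm (key T' T h' h (fun r i h1 h2 => (heq r i h1 h2).symm) j c hc)
      (key T T' h h' heq j c hc)
  · rw [h.2.1 j c hc, h'.2.1 j c hc]

theorem GTP.row_mono {k L} (hL : GTP k L) (r : ℕ) (hr : r < k) : ∀ i' i, i ≤ i' → i' ≤ r →
    L r i ≤ L r i' := by
  intro i'
  induction i' with
  | zero => intro i h1 h2; obtain rfl : i = 0 := by omega
            rfl
  | succ i' ih =>
    intro i h1 h2
    by_cases h : i = i' + 1
    · rw [h]
    · have h3 := ih i (by omega) (by omega)
      obtain ⟨r, rfl⟩ : ∃ q, r = q + 1 := ⟨r - 1, by omega⟩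
      have h4 := hL.le1 r i' (by omega) hr
      have h5 := hL.le2 r i' (by omega) hr
      omega

theorem GTP.diag_mono {k L} (hL : GTP k L) (j : ℕ) : ∀ r' r, j ≤ r → r ≤ r' → r' < k →
    L r (r - j) ≤ L r' (r' - j) := by
  intro r'
  induction r' with
  | zero => intro r h1 h2 h3; obtain rfl : r = 0 := by omega
            rfl
  | succ r' ih =>
    intro r h1 h2 h3
    by_cases h : r = r' + 1
    · rw [h]
    · have h4 := ih r h1 (by omega) (by omega)
      have h5 := hL.le2 r' (r' - j) (by omega) h3
      rw [show r' + 1 - j = r' - j + 1 by omega]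
      omega

theorem GTP.exists_tab {k L} {lam : ℕ → ℕ} (hL : GTP k L) (hl0 : ∀ j, k ≤ j → lam j = 0)
    (htop : ∀ i, i < k → L (k-1) i = lam (k-1-i)) :
    ∃ T, IsSSYT k lam T ∧ ∀ r i, i ≤ r → r < k → pat lam T r i = L r i := by
  classical
  let A : ℕ → ℕ → Finset ℕ := fun j c =>
    (Finset.range k).filter (fun r => r < j ∨ L r (r - j) ≤ c)
  let T : ℕ → ℕ → ℕ := fun j c => if c < lam j then (A j c).card else 0
  have hjk : ∀ j c, c < lam j → j < k := by
    intro j c hc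
    by_contra h
    rw [hl0 j (by omega)] at hc
    omega
  have hT : ∀ j c, c < lam j → ∀ r, r < k → (T j c ≤ r ↔ j ≤ r ∧ (c : ℤ) < L r (r - j)) := by
    intro j c hc r hr
    simp only [T, hc, if_true]
    rw [← not_lt, ← mem_iff_lt_card]
    · simp only [A, Finset.mem_filter, Finset.mem_range, hr, true_and, not_or, not_lt, not_le]
    · intro a b hab hb
      simp only [A, Finset.mem_filter, Finset.mem_range] at hb ⊢
      refine ⟨by omega, ?_⟩
      by_cases h : a < j
      · exact Or.inl h
      · right
        have := hL.diag_mono j b a (by omega) hab hb.1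
        omega
  have hlt : ∀ j c, c < lam j → T j c < k := by
    intro j c hc
    have h1 := hjk j c hc
    have h2 := (hT j c hc (k-1) (by omega)).2
    rw [htop _ (by omega), show k - 1 - (k - 1 - j) = j by omega] at h2
    have := h2 ⟨by omega, by exact_mod_cast hc⟩
    omega
  refine ⟨T, ⟨hlt, ?_, ?_, ?_⟩, ?_⟩
  · intro j c hc
    simp [T, hc]
  · intro j c c' hcc hc'
    have h1 := (hT j c' hc' _ (hlt j c' hc')).1 le_rfl
    exact (hT j c (by omega) _ (hlt j c' hc')).2 ⟨h1.1, by omega⟩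
  · intro j j' c hjj hc
    have hj'k := hjk j' c hc
    have hc' : c < lam j := by
      have h1 := hL.row_mono (k-1) (by omega) (k-1-j) (k-1-j') (by omega) (by omega)
      rw [htop _ (by omega), htop _ (by omega), show k - 1 - (k - 1 - j) = j by omega,
        show k - 1 - (k - 1 - j') = j' by omega] at h1
      omega
    by_contra hcon
    have htk := hlt j c hc'
    obtain ⟨h1, h2⟩ := (hT j' c hc (T j c) htk).1 (by omega)
    generalize ht : T j c = t at *
    obtain ⟨t, rfl⟩ : ∃ q, t = q + 1 := ⟨t - 1, by omega⟩
    have h3 := hL.row_mono (t+1) htk (t - j) (t + 1 - j') (by omega) (by omega)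
    have h4 := hL.le1 t (t - j) (by omega) htk
    have h5 := (hT j c hc' t (by omega)).2 ⟨by omega, by omega⟩
    omega
  · intro r i hi hr
    have h0 := hL.nonneg r i hi hr
    obtain ⟨N, hN⟩ := Int.eq_ofNat_of_zero_le h0
    unfold pat tabN
    rw [hN]
    norm_cast
    have h1 := hL.diag_mono (r - i) (k-1) r (by omega) (by omega) (by omega)
    rw [htop _ (by omega), show k - 1 - (k - 1 - (r - i)) = r - i by omega,
      show r - (r - i) = i by omega, hN] at h1
    rw [show (Finset.range (lam (r-i))).filter (fun c => T (r-i) c ≤ r) = Finset.range N from ?_,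
      Finset.card_range]
    ext c
    simp only [Finset.mem_filter, Finset.mem_range]
    constructor
    · rintro ⟨h2, h3⟩
      have := ((hT _ c h2 r hr).1 h3).2
      rw [show r - (r - i) = i by omega, hN] at this
      omega
    · intro h2
      have h3 : c < lam (r - i) := by omega
      refine ⟨h3, (hT _ c h3 r hr).2 ⟨by omega, ?_⟩⟩
      rw [show r - (r - i) = i by omega, hN]
      omega

theorem entryCount_eq (k : ℕ) (lam : ℕ → ℕ) (T : ℕ → ℕ → ℕ) (v : ℕ) :
    entryCount k lam T v = ∑ j ∈ Finset.range k,
      ((Finset.range (lam j)).filter (fun c => T j c = v)).card := by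
  unfold entryCount cells
  rw [Finset.filter_filter, Finset.card_filter, Finset.sum_product]
  apply Finset.sum_congr rfl
  intro j hj
  rw [← Finset.card_filter]
  congr 1
  ext c
  have : lam j ≤ (Finset.range k).sup lam := Finset.le_sup hj
  simp only [Finset.mem_filter, Finset.mem_range]
  constructor
  · rintro ⟨_, h⟩; exact h
  · rintro h; exact ⟨by omega, h⟩

theorem IsSSYT.sum_entryCount {k lam T} (h : IsSSYT k lam T) (hl : ∀ j, lam (j+1) ≤ lam j)
    (r : ℕ) (hr : r < k) : ((∑ v ∈ Finset.range (r+1), entryCount k lam T v : ℕ) : ℤ) =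
      ∑ i ∈ Finset.range (r+1), pat lam T r i := by
  have h1 : ∑ v ∈ Finset.range (r+1), entryCount k lam T v =
      ∑ j ∈ Finset.range k, tabN lam T r j := by
    simp only [entryCount_eq]
    rw [Finset.sum_comm]
    apply Finset.sum_congr rfl
    intro j _
    unfold tabN
    rw [Finset.card_eq_sum_card_fiberwise (f := fun c => T j c) (t := Finset.range (r+1))]
    · apply Finset.sum_congr rfl
      intro v hv
      congr 1
      ext c
      simp only [Finset.mem_filter, Finset.mem_range] at hv ⊢
      omega
    · intro c hc
      simp at hc ⊢
      omega
  have h2 : ∑ j ∈ Finset.range k, tabN lam T r j = ∑ j ∈ Finset.range (r+1), tabN lam T r j := by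
    symm
    apply Finset.sum_subset
    · intro j hj; simp at hj ⊢; omega
    · intro j _ hj
      unfold tabN
      rw [Finset.card_eq_zero, Finset.filter_eq_empty_iff]
      intro c hc
      have := h.ge_row hl j c (by simpa using hc)
      simp at hj
      omega
  rw [h1, h2, ← Finset.sum_range_reflect]
  push_cast
  apply Finset.sum_congr rfl
  intro i _
  unfold pat
  simp

theorem entryCount_eq_wcnt {k lam T n u P} (h : IsSSYT k lam T) (hl : ∀ j, lam (j+1) ≤ lam j)
    (hP : Chain k n u P) (heq : ∀ r i, i ≤ r → r < k → pat lam T r i = P n r i) :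
    ∀ v < k, (entryCount k lam T v : ℤ) = wcnt u v n := by
  have key : ∀ r < k, ∑ v ∈ Finset.range (r+1), (entryCount k lam T v : ℤ) =
      ∑ v ∈ Finset.range (r+1), wcnt u v n := by
    intro r hr
    rw [← hP.sum_row n le_rfl r hr]
    have := h.sum_entryCount hl r hr
    push_cast at this
    rw [this]
    apply Finset.sum_congr rfl
    intro i hi
    exact heq r i (by simp at hi; omega) hr
  intro v hv
  have h1 := key v hv
  rw [Finset.sum_range_succ, Finset.sum_range_succ] at h1
  rcases v with _ | v
  · simpa using h1
  · rw [key v (by omega)] at h1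
    exact add_left_cancel h1

/-- extension of a finite word by zeros -/
def wext {n k : ℕ} (u : Fin n → Fin k) (m : ℕ) : ℕ := if h : m < n then (u ⟨m, h⟩ : ℕ) else 0

theorem wext_lt {n k : ℕ} (u : Fin n → Fin k) (m : ℕ) (h : m < n) : wext u m < k := by
  simp [wext, h]

theorem schur_eq_sum (k : ℕ) (hk : 0 < k) (n : ℕ) (g : ℕ → ℕ → ℤ) (hg : WPath k n g)
    (p : ℕ → ℝ) :
    schur k (revPartZ k (fun i => g i n)) p =
      ∑' u : {u : Fin n → Fin k // ∀ m ≤ n, ∀ i, i < k → G k (wcnt (wext u)) i m = g i m},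
        ∏ m : Fin n, p (u.1 m) := by
  set lam := revPartZ k (fun i => g i n) with hlam
  have hl0 : ∀ j, k ≤ j → lam j = 0 := by
    intro j hj
    simp only [hlam, revPartZ, not_lt.2 hj, if_false]
  have hl : ∀ j, lam (j+1) ≤ lam j := by
    intro j
    by_cases h : j + 1 < k
    · simp only [hlam, revPartZ, h, if_true, show j < k by omega]
      have := hg.mono n le_rfl (k - 1 - (j+1)) (by omega)
      rw [show k - 1 - (j + 1) + 1 = k - 1 - j by omega] at this
      exact Int.toNat_le_toNat this
    · rw [hl0 (j+1) (by omega)]; omega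
  have hltop : ∀ i, i < k → (lam (k-1-i) : ℤ) = g i n := by
    intro i hi
    simp only [hlam, revPartZ, show k - 1 - i < k by omega, if_true,
      show k - 1 - (k - 1 - i) = i by omega]
    exact Int.toNat_of_nonneg (hg.nonneg n le_rfl i hi)
  have hch : ∀ u : Fin n → Fin k, ∃ P, Chain k n (wext u) P :=
    fun u => Chain.exists_fwd n (wext u) (wext_lt u)
  choose P hP using hch
  have htab : ∀ u : {u : Fin n → Fin k // ∀ m ≤ n, ∀ i, i < k →
      G k (wcnt (wext u)) i m = g i m}, ∃ T, IsSSYT k lam T ∧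
      ∀ r i, i ≤ r → r < k → pat lam T r i = P u.1 n r i := by
    intro u
    apply ((hP u.1).gtp n le_rfl).exists_tab hl0
    intro i hi
    rw [← (hP u.1).G_eq n le_rfl i hi, u.2 n le_rfl i hi, hltop i hi]
  choose T hT hTP using htab
  have htop : ∀ u : {u : Fin n → Fin k // ∀ m ≤ n, ∀ i, i < k →
      G k (wcnt (wext u)) i m = g i m}, ∀ m ≤ n, ∀ i, i < k → P u.1 m (k-1) i = g i m := by
    intro u m hm i hi
    rw [← (hP u.1).G_eq m hm i hi, u.2 m hm i hi]
  have hbij : Function.Bijective (fun u => (⟨T u, hT u⟩ : {T // IsSSYT k lam T})) := by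
    constructor
    · intro u v huv
      have huv' : T u = T v := congrArg Subtype.val huv
      have h1 := Chain.back_unique g n _ _ _ _ (hP u.1) (hP v.1) (htop u) (htop v)
        (by intro r i hi hr
            rw [← hTP u r i hi hr, ← hTP v r i hi hr, huv'])
      apply Subtype.ext
      funext m
      have := h1 m m.2
      simp only [wext, m.2, dif_pos] at this
      exact Fin.ext this
    · rintro ⟨S, hS⟩
      obtain ⟨w, Q, hQ, hw, hQn, hQt⟩ := Chain.exists_back hk g n hg (pat lam S) (hS.gtp hl)
        (fun i hi => by rw [hS.pat_top i hi, hltop i hi])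
      let u : Fin n → Fin k := fun m => ⟨w m, hw m⟩
      have hu : ∀ m, m < n → wext u m = w m := by
        intro m hm
        simp [wext, hm, u]
      have hQ' : Chain k n (wext u) Q :=
        ⟨hQ.zero, hQ.gtp, fun m hm => by rw [hu m hm]; exact hQ.ins m hm⟩
      refine ⟨⟨u, fun m hm i hi => by rw [hQ'.G_eq m hm i hi, hQt m hm i hi]⟩, ?_⟩
      apply Subtype.ext
      apply IsSSYT.ext_pat (hT _) hS hl
      intro r i hi hr
      rw [hTP _ r i hi hr, ← hQn]
      have h1 := (hP u).char n le_rfl i (r - i) (by omega)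
      have h2 := hQ'.char n le_rfl i (r - i) (by omega)
      rw [show r - i + i = r by omega] at h1 h2
      rw [← h1, ← h2]
  unfold schur
  rw [← (Equiv.ofBijective _ hbij).tsum_eq]
  apply tsum_congr
  intro u
  simp only [Equiv.ofBijective_apply]
  have h1 := entryCount_eq_wcnt (hT u) hl (hP u.1) (hTP u)
  have h2 : ∏ m : Fin n, p (u.1 m) = ∏ m ∈ Finset.range n, p (wext u.1 m) := by
    rw [Finset.prod_range]
    apply Finset.prod_congr rfl
    intro m _
    simp [wext]
  rw [h2, ← Finset.prod_fiberwise_of_maps_to (s := Finset.range n) (g := wext u.1) (t := Finset.range k)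
    (fun m hm => by simpa using wext_lt u.1 m (by simpa using hm))]
  apply Finset.prod_congr rfl
  intro v hv
  have h3 := h1 v (by simpa using hv)
  unfold wcnt at h3
  rw [Nat.cast_inj.1 h3]
  rw [← Finset.prod_const]
  apply Finset.prod_congr rfl
  intro m hm
  rw [(Finset.mem_filter.1 hm).2]

theorem stmt11_aux {Ω : Type*} [MeasureSpace Ω] [IsProbabilityMeasure (ℙ : Measure Ω)]
    (k : ℕ) (p : ℕ → ℝ)
    (hp0 : ∀ i, i < k → 0 ≤ p i)
    (hsum : ∑ i ∈ Finset.range k, p i = 1)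
    (ξ : ℕ → Ω → ℕ) (hmeas : ∀ m, Measurable (ξ m))
    (hindep : iIndepFun ξ ℙ)
    (hlaw : ∀ m i, i < k → ℙ {ω | ξ m ω = i} = ENNReal.ofReal (p i))
    (n : ℕ) (S : Set (Fin n → Fin k)) (A : Set Ω)
    (hA : ∀ ω, ∀ u : Fin n → Fin k, (∀ m : Fin n, ξ m ω = u m) → (ω ∈ A ↔ u ∈ S)) :
    ℙ A = ENNReal.ofReal (∑' u : S, ∏ m : Fin n, p (u.1 m)) := by
  classical
  have hlt : ∀ m, ∀ᵐ ω, ξ m ω < k := by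
    intro m
    have h1 : {ω | ξ m ω < k} = ⋃ i ∈ Finset.range k, {ω | ξ m ω = i} := by
      ext ω; simp
    have h2 : ℙ {ω | ξ m ω < k} = 1 := by
      rw [h1, measure_biUnion_finset]
      · rw [Finset.sum_congr rfl (fun i hi => hlaw m i (by simpa using hi)),
          ← ENNReal.ofReal_sum_of_nonneg (fun i hi => hp0 i (by simpa using hi)), hsum,
          ENNReal.ofReal_one]
      · intro i _ j _ hij
        rw [Function.onFun, Set.disjoint_left]
        intro ω h3 h4
        exact hij (h3.symm.trans h4)
      · intro i _
        exact hmeas m (measurableSet_singleton i)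
    have hm : MeasurableSet {ω | ξ m ω < k} := hmeas m measurableSet_Iio
    exact (prob_compl_eq_zero_iff hm).2 h2
  have hall : ∀ᵐ ω, ∀ m, ξ m ω < k := ae_all_iff.2 hlt
  have hcyl : ∀ u : Fin n → Fin k, MeasurableSet {ω | ∀ m : Fin n, ξ m ω = u m} := by
    intro u
    have : {ω | ∀ m : Fin n, ξ m ω = u m} = ⋂ m : Fin n, ξ m ⁻¹' {(u m : ℕ)} := by
      ext ω; simp
    rw [this]
    exact MeasurableSet.iInter (fun m => hmeas m (measurableSet_singleton _))
  have hpr : ∀ u : Fin n → Fin k, ℙ {ω | ∀ m : Fin n, ξ m ω = u m} =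
      ENNReal.ofReal (∏ m : Fin n, p (u m)) := by
    intro u
    have hi : iIndepFun (fun m : Fin n => ξ m) ℙ := hindep.precomp Fin.val_injective
    have h1 := hi.measure_inter_preimage_eq_mul Finset.univ
      (sets := fun m : Fin n => {(u m : ℕ)}) (fun m _ => measurableSet_singleton _)
    have : {ω | ∀ m : Fin n, ξ m ω = u m} = ⋂ m ∈ Finset.univ, ξ (m : Fin n) ⁻¹' {(u m : ℕ)} := by
      ext ω; simp
    rw [this, h1, ENNReal.ofReal_prod_of_nonneg (fun m _ => hp0 _ (u m).2)]
    apply Finset.prod_congr rfl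
    intro m _
    exact hlaw m (u m) (u m).2
  have hAe : ℙ A = ℙ (⋃ u ∈ S.toFinset, {ω | ∀ m : Fin n, ξ m ω = u m}) := by
    apply measure_congr
    filter_upwards [hall] with ω hω
    apply propext
    change ω ∈ A ↔ ω ∈ (⋃ u ∈ S.toFinset, {ω | ∀ m : Fin n, ξ m ω = u m} : Set Ω)
    rw [hA ω (fun m => ⟨ξ m ω, hω m⟩) (fun m => rfl)]
    simp only [Set.mem_iUnion, Set.mem_toFinset, Set.mem_setOf_eq, exists_prop]
    constructor
    · intro h; exact ⟨_, h, fun m => rfl⟩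
    · rintro ⟨u, hu, h⟩
      convert hu using 1
      funext m
      exact Fin.ext (h m)
  rw [hAe, measure_biUnion_finset]
  · rw [tsum_fintype, Finset.sum_congr rfl (fun u _ => hpr u),
      ← ENNReal.ofReal_sum_of_nonneg (fun u _ => Finset.prod_nonneg fun m _ => hp0 _ (u m).2)]
    congr 1
    exact (Finset.sum_subtype S.toFinset (fun u => Set.mem_toFinset)
      (fun u => ∏ m : Fin n, p (u m)))
  · intro u _ v _ huv
    rw [Function.onFun, Set.disjoint_left]
    intro ω h1 h2
    apply huv
    funext m
    exact Fin.ext ((h1 m).symm.trans (h2 m))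
  · intro u _
    exact hcyl u

/-- the probability that the transformed walk `G^{(k)}(X)` follows
a given path `g` in the Weyl chamber up to time `n` equals the Schur polynomial
`s_{g(n)^*}(p)`. -/
theorem stmt11 {Ω : Type*} [MeasureSpace Ω] [IsProbabilityMeasure (ℙ : Measure Ω)]
    (k : ℕ) (hk : 2 ≤ k) (p : ℕ → ℝ)
    (hp0 : ∀ i, i < k → 0 ≤ p i)
    (hsum : ∑ i ∈ Finset.range k, p i = 1)
    (ξ : ℕ → Ω → ℕ) (hmeas : ∀ m, Measurable (ξ m))
    (hindep : iIndepFun ξ ℙ)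
    (hlaw : ∀ m i, i < k → ℙ {ω | ξ m ω = i} = ENNReal.ofReal (p i))
    (n : ℕ) (hn : 1 ≤ n) (g : ℕ → ℕ → ℤ)
    (hg0 : ∀ i, i < k → g i 0 = 0)
    (hgstep : ∀ m, 1 ≤ m → m ≤ n →
      ∃ j, j < k ∧ g j m = g j (m-1) + 1 ∧ ∀ i, i < k → i ≠ j → g i m = g i (m-1))
    (hgW : ∀ m ≤ n, ∀ i, i + 1 < k → g i m ≤ g (i+1) m) :
    ℙ {ω | ∀ m ≤ n, ∀ i, i < k → G k (fun i' n' => Xcnt ξ i' n' ω) i m = g i m}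
      = ENNReal.ofReal (schur k (revPartZ k (fun i => g i n)) p) := by
  have hg : WPath k n g := ⟨hg0, fun m hm => by
    simpa using hgstep (m+1) (by omega) (by omega), hgW⟩
  rw [schur_eq_sum k (by omega) n g hg p]
  apply stmt11_aux k p hp0 hsum ξ hmeas hindep hlaw n
    {u : Fin n → Fin k | ∀ m ≤ n, ∀ i, i < k → G k (wcnt (wext u)) i m = g i m}
  intro ω u hu
  have h1 : ∀ m < n, ξ m ω = wext u m := by
    intro m hm
    have := hu ⟨m, hm⟩
    simpa [wext, hm] using this
  have h2 : ∀ m ≤ n, ∀ i, i < k → G k (fun i' n' => Xcnt ξ i' n' ω) i m =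
      G k (wcnt (wext u)) i m := by
    intro m hm i hi
    exact G_local (u := fun m => ξ m ω) h1 i hi m hm
  simp only [Set.mem_setOf_eq]
  constructor
  · intro h m hm i hi
    rw [← h2 m hm i hi]; exact h m hm i hi
  · intro h m hm i hi
    rw [h2 m hm i hi]; exact h m hm i hi
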